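/- Precision accuracy: there exist constants M > 0 depending only on K₁,…,K₅, L₁, L₂, C₀, r and K > 0 depending only on K₂, K₃, K₄, K₅, L₃, λ̄₀, C₀ such that the following holds. If t₀ ≥ ⌈M(p·log(max(p,3)) + x)⌉ and assumptions (A1), (A2), (A3), (A4), (A5) hold, then for every t ∈ ℕ with t > t₀, both ‖Ω_t^{−1/2} F_{t,θ⋆} Ω_t^{−1/2} − I_p‖₂ ≤ K √((p log t + x)/t) and ‖F_{t,θ⋆}^{−1/2} Ω_t F_{t,θ⋆}^{−1/2} − I_p‖₂ ≤ K √((p log t + x)/t). -/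

import Mathlib

open Matrix MeasureTheory Real
open scoped RealInnerProductSpace BigOperators ENNReal

noncomputable section

/-- Vectors in `ℝ^p` with the Euclidean (`ℓ²`) norm. -/
abbrev Vec (p : ℕ) := EuclideanSpace ℝ (Fin p)

/-- Real `p × p` matrices. -/
abbrev Mat (p : ℕ) := Matrix (Fin p) (Fin p) ℝ

/-- A matrix applied to a Euclidean vector. -/
def mApp {p : ℕ} (A : Mat p) (v : Vec p) : Vec p := Matrix.toEuclideanLin A v

/-- The quadratic form `vᵀ A v`.  For positive semidefinite `A` this equals
`‖A^{1/2} v‖₂²`. -/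
def quadForm {p : ℕ} (A : Mat p) (v : Vec p) : ℝ := ⟪v, mApp A v⟫

/-- The `ℓ² → ℓ²` operator (spectral) norm of a matrix. -/
def specNorm {p : ℕ} (A : Mat p) : ℝ :=
  ‖LinearMap.toContinuousLinearMap (Matrix.toEuclideanLin A)‖

/-- The exit time `t_exit = inf {t ∈ ℕ : t > t₀, θ_t ∉ Θ_r}`, valued in `ℕ∞`
(with `inf ∅ = ∞`). -/
def texit {p : ℕ} (θstar : Vec p) (r : ℝ) (t₀ : ℕ) (θ : ℕ → Vec p) : ℕ∞ :=
  sInf {n : ℕ∞ | ∃ t : ℕ, n = (t : ℕ∞) ∧ t₀ < t ∧ r < ‖θ t - θstar‖}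

/-- `F_{t,θ} = Σ_{s=1}^{t} ∇²ℓ_s(θ)`. -/
def Fmat {p : ℕ} (hess : ℕ → Vec p → Mat p) (t : ℕ) (y : Vec p) : Mat p :=
  ∑ s ∈ Finset.Icc 1 t, hess s y

/-- The approximation rate `ε_{app,t} = √( (log(t/t₀))²(p log t + x)² / t )`. -/
def epsApp (t₀ p : ℕ) (x : ℝ) (t : ℕ) : ℝ :=
  Real.sqrt ((Real.log ((t : ℝ) / (t₀ : ℝ))) ^ 2 * ((p : ℝ) * Real.log t + x) ^ 2 / t)

section BasicLemmas

variable {p : ℕ}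

lemma mApp_add_mat (A B : Mat p) (v : Vec p) : mApp (A + B) v = mApp A v + mApp B v := by
  simp [mApp, map_add]

lemma mApp_sub_mat (A B : Mat p) (v : Vec p) : mApp (A - B) v = mApp A v - mApp B v := by
  simp [mApp, map_sub]

lemma mApp_sub_vec (A : Mat p) (v w : Vec p) : mApp A (v - w) = mApp A v - mApp A w := by
  simp [mApp, map_sub]

lemma mApp_smul_vec (A : Mat p) (c : ℝ) (v : Vec p) : mApp A (c • v) = c • mApp A v := by
  simp [mApp]

lemma mApp_mul (A B : Mat p) (v : Vec p) : mApp (A * B) v = mApp A (mApp B v) := by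
  simp [mApp, Matrix.toLpLin_apply]

lemma mApp_one (v : Vec p) : mApp (1 : Mat p) v = v := by
  simp [mApp]

lemma quadForm_add (A B : Mat p) (v : Vec p) :
    quadForm (A + B) v = quadForm A v + quadForm B v := by
  simp [quadForm, mApp_add_mat, inner_add_right]

lemma quadForm_sub (A B : Mat p) (v : Vec p) :
    quadForm (A - B) v = quadForm A v - quadForm B v := by
  simp [quadForm, mApp_sub_mat, inner_sub_right]

lemma quadForm_smul_mat (c : ℝ) (A : Mat p) (v : Vec p) :
    quadForm (c • A) v = c * quadForm A v := by
  simp [quadForm, mApp, inner_smul_right]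

lemma quadForm_smul_vec (A : Mat p) (c : ℝ) (v : Vec p) :
    quadForm A (c • v) = c ^ 2 * quadForm A v := by
  simp only [quadForm, mApp_smul_vec, inner_smul_right, inner_smul_left]
  simp; ring

lemma quadForm_eq_dot (A : Mat p) (v : Vec p) :
    quadForm A v = star v.ofLp ⬝ᵥ A *ᵥ v.ofLp := by
  rw [quadForm, EuclideanSpace.inner_eq_star_dotProduct, dotProduct_comm]
  simp [mApp, Matrix.toLpLin_apply]

lemma quadForm_nonneg {A : Mat p} (hA : A.PosSemidef) (v : Vec p) : 0 ≤ quadForm A v := by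
  rw [quadForm_eq_dot]; exact hA.dotProduct_mulVec_nonneg _

lemma posDef_of_quadForm {A : Mat p} (hA : A.IsHermitian) {k : ℝ} (hk : 0 < k)
    (h : ∀ v : Vec p, k * ‖v‖ ^ 2 ≤ quadForm A v) : A.PosDef := by
  refine Matrix.PosDef.of_dotProduct_mulVec_pos hA fun w hw => ?_
  have h1 := h (WithLp.toLp 2 w)
  rw [quadForm_eq_dot] at h1
  have h2 : (WithLp.toLp 2 w : Vec p) ≠ 0 := by
    intro h0; apply hw; simpa using congrArg WithLp.ofLp h0
  have h3 : 0 < ‖(WithLp.toLp 2 w : Vec p)‖ := norm_pos_iff.mpr h2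
  have : 0 < k * ‖(WithLp.toLp 2 w : Vec p)‖ ^ 2 := by positivity
  linarith

lemma norm_mApp_le (A : Mat p) (v : Vec p) : ‖mApp A v‖ ≤ specNorm A * ‖v‖ :=
  (LinearMap.toContinuousLinearMap (Matrix.toEuclideanLin A)).le_opNorm v

lemma specNorm_nonneg (A : Mat p) : 0 ≤ specNorm A := norm_nonneg _

lemma quadForm_le_specNorm (A : Mat p) (v : Vec p) : quadForm A v ≤ specNorm A * ‖v‖ ^ 2 := by
  have h1 := real_inner_le_norm v (mApp A v)
  have h2 := norm_mApp_le A v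
  have h3 := norm_nonneg v
  unfold quadForm
  nlinarith

open scoped Matrix.Norms.L2Operator in
lemma specNorm_eq (A : Mat p) : specNorm A = ‖A‖ := rfl

open scoped Matrix.Norms.L2Operator in
lemma specNorm_add_le (A B : Mat p) : specNorm (A + B) ≤ specNorm A + specNorm B := by
  simp only [specNorm_eq]; exact norm_add_le _ _

open scoped Matrix.Norms.L2Operator in
lemma specNorm_neg (A : Mat p) : specNorm (-A) = specNorm A := by
  simp only [specNorm_eq]; exact norm_neg _

open scoped Matrix.Norms.L2Operator in
lemma specNorm_sum_le (s : Finset ℕ) (f : ℕ → Mat p) :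
    specNorm (∑ i ∈ s, f i) ≤ ∑ i ∈ s, specNorm (f i) := by
  simp only [specNorm_eq]; exact norm_sum_le _ _

lemma specNorm_mul_le (A B : Mat p) : specNorm (A * B) ≤ specNorm A * specNorm B := by
  simp only [specNorm_eq]; exact Matrix.l2_opNorm_mul _ _

lemma specNorm_sq {S : Mat p} (hS : S.IsHermitian) : specNorm (S * S) = specNorm S * specNorm S := by
  simp only [specNorm_eq]
  conv_lhs => rw [show S * S = Sᴴ * S by rw [hS.eq]]
  exact Matrix.l2_opNorm_conjTranspose_mul_self S

lemma specNorm_le_bound (A : Mat p) {c : ℝ} (hc : 0 ≤ c) (h : ∀ v, ‖mApp A v‖ ≤ c * ‖v‖) :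
    specNorm A ≤ c := ContinuousLinearMap.opNorm_le_bound _ hc h

lemma inner_mApp_symm {A : Mat p} (hA : A.IsHermitian) (v w : Vec p) :
    ⟪mApp A v, w⟫ = ⟪v, mApp A w⟫ :=
  (Matrix.isSymmetric_toEuclideanLin_iff.mpr hA) v w

/-- spectral norm of a psd matrix with bounded quadratic form -/
lemma specNorm_le_of_quadForm {A : Mat p} (hA : A.PosSemidef) {c : ℝ} (hc : 0 ≤ c)
    (h : ∀ v : Vec p, quadForm A v ≤ c * ‖v‖ ^ 2) : specNorm A ≤ c := by
  refine specNorm_le_bound A hc fun v => ?_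
  set w := mApp A v with hw
  -- expand the nonnegative quantity
  by_cases hc0 : c = 0
  · have key : ∀ u : Vec p, ∀ s : ℝ, 0 ≤ quadForm A (v - s • w) := fun _ s => quadForm_nonneg hA _
    have hx : ∀ s : ℝ, quadForm A (v - s • w) =
        quadForm A v - 2 * s * ‖w‖ ^ 2 + s ^ 2 * quadForm A w := by
      intro s
      simp only [quadForm, mApp_sub_vec, mApp_smul_vec, inner_sub_left, inner_sub_right,
        inner_smul_left, inner_smul_right]
      rw [← inner_mApp_symm hA.isHermitian v w, ← hw, real_inner_self_eq_norm_sq]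
      simp; ring
    have h1 := key v 1
    rw [hx] at h1
    have h2 := h v
    have h3 := h w
    rw [hc0] at h2 h3 ⊢
    have : ‖w‖ ^ 2 ≤ 0 := by nlinarith
    have : ‖w‖ = 0 := by
      have := sq_nonneg ‖w‖
      exact pow_eq_zero_iff (two_ne_zero) |>.mp (by linarith)
    simp [this]
  · have hcp : 0 < c := lt_of_le_of_ne hc (Ne.symm hc0)
    have hx : ∀ s : ℝ, quadForm A (v - s • w) =
        quadForm A v - 2 * s * ‖w‖ ^ 2 + s ^ 2 * quadForm A w := by
      intro s
      simp only [quadForm, mApp_sub_vec, mApp_smul_vec, inner_sub_left, inner_sub_right,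
        inner_smul_left, inner_smul_right]
      rw [← inner_mApp_symm hA.isHermitian v w, ← hw, real_inner_self_eq_norm_sq]
      simp; ring
    have h1 := quadForm_nonneg hA (v - c⁻¹ • w)
    rw [hx] at h1
    have h2 := h v
    have h3 := h w
    have h4 : (c⁻¹) ^ 2 * quadForm A w ≤ c⁻¹ * ‖w‖ ^ 2 := by
      calc (c⁻¹) ^ 2 * quadForm A w ≤ (c⁻¹) ^ 2 * (c * ‖w‖ ^ 2) := by gcongr
        _ = c⁻¹ * ‖w‖ ^ 2 := by field_simp
    have h5 : c⁻¹ * ‖w‖ ^ 2 ≤ c * ‖v‖ ^ 2 := by nlinarith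
    have h6 : ‖w‖ ^ 2 ≤ (c * ‖v‖) ^ 2 := by
      have := mul_le_mul_of_nonneg_left h5 hc
      rw [← mul_assoc, mul_inv_cancel₀ hc0, one_mul] at this
      nlinarith
    exact le_of_sq_le_sq h6 (by positivity)

lemma specNorm_inv_le {A : Mat p} (hA : A.PosDef) {k : ℝ} (hk : 0 < k)
    (h : ∀ v : Vec p, k * ‖v‖ ^ 2 ≤ quadForm A v) : specNorm A⁻¹ ≤ k⁻¹ := by
  refine specNorm_le_bound _ (by positivity) fun v => ?_
  have hdet : IsUnit A.det := (Matrix.isUnit_iff_isUnit_det A).mp hA.isUnit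
  set w := mApp A⁻¹ v with hw
  have hv : mApp A w = v := by
    rw [hw, ← mApp_mul, Matrix.mul_nonsing_inv _ hdet, mApp_one]
  have h1 := h w
  unfold quadForm at h1
  rw [hv] at h1
  have h2 := real_inner_le_norm w v
  have h3 := norm_nonneg w
  rw [inv_mul_eq_div, le_div_iff₀ hk]
  rcases h3.eq_or_lt with h0 | h0
  · rw [← h0]; simp
  · have : ‖w‖ * (k * ‖w‖) ≤ ‖w‖ * ‖v‖ := by nlinarith
    have := le_of_mul_le_mul_left this h0
    linarith

/-- the sandwich bound -/
lemma sandwich {A B S : Mat p} (hA : A.PosDef) {k : ℝ} (hk : 0 < k)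
    (h : ∀ v : Vec p, k * ‖v‖ ^ 2 ≤ quadForm A v) (hS : S.PosSemidef) (hSS : S * S = A⁻¹) :
    specNorm (S * B * S - 1) ≤ specNorm (B - A) / k := by
  have hdet : IsUnit A.det := (Matrix.isUnit_iff_isUnit_det A).mp hA.isUnit
  have h1 : S * (S * A) = 1 := by
    rw [← mul_assoc, hSS, Matrix.nonsing_inv_mul _ hdet]
  have h2 : S * A * S = 1 := mul_eq_one_comm.mp h1
  have h3 : S * B * S - 1 = S * (B - A) * S := by
    rw [mul_sub, sub_mul, h2]
  rw [h3]
  have h4 := specNorm_inv_le hA hk h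
  rw [← hSS, specNorm_sq hS.isHermitian] at h4
  have h5 := specNorm_mul_le (S * (B - A)) S
  have h6 := specNorm_mul_le S (B - A)
  have h7 := specNorm_nonneg S
  have h8 := specNorm_nonneg (B - A)
  calc _ ≤ specNorm S * specNorm (B - A) * specNorm S := by nlinarith
    _ = specNorm (B - A) * (specNorm S * specNorm S) := by ring
    _ ≤ specNorm (B - A) * k⁻¹ := by gcongr
    _ = _ := by rw [div_eq_mul_inv]

lemma hess_symm {f : Vec p → ℝ} {g : Vec p → Vec p} {H : Mat p} {y : Vec p}
    (hf : ∀ y, HasGradientAt f (g y) y)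
    (hg : HasFDerivAt g (LinearMap.toContinuousLinearMap (Matrix.toEuclideanLin H)) y) :
    H.IsHermitian := by
  rw [← Matrix.isSymmetric_toEuclideanLin_iff]
  intro v w
  have h1 : HasFDerivAt (fun y => (innerSL ℝ (g y) : Vec p →L[ℝ] ℝ))
      ((innerSL ℝ : Vec p →L[ℝ] Vec p →L[ℝ] ℝ).comp
        (LinearMap.toContinuousLinearMap (Matrix.toEuclideanLin H))) y :=
    (innerSL ℝ : Vec p →L[ℝ] Vec p →L[ℝ] ℝ).hasFDerivAt.comp y hg
  have h2 : ∀ y, HasFDerivAt f (innerSL ℝ (g y) : Vec p →L[ℝ] ℝ) y := fun y => (hf y).hasFDerivAt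
  have h3 := second_derivative_symmetric h2 h1 v w
  rw [real_inner_comm (Matrix.toEuclideanLin H w) v]
  simpa using h3

/-- one step of the recursion for the potential -/
lemma step_identity {A H : Mat p} {d g : Vec p} (hA : (A + H).PosDef) :
    quadForm (A + H) (d - mApp (A + H)⁻¹ g) =
      quadForm A d + quadForm H d - 2 * ⟪g, d⟫ + quadForm (A + H)⁻¹ g := by
  rw [← quadForm_add]
  set B := A + H
  have hdet : IsUnit B.det := (Matrix.isUnit_iff_isUnit_det B).mp hA.isUnit
  have h1 : mApp B (mApp B⁻¹ g) = g := by
    rw [← mApp_mul, Matrix.mul_nonsing_inv _ hdet, mApp_one]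
  have h2 : ⟪mApp B⁻¹ g, mApp B d⟫ = ⟪g, d⟫ := by
    rw [← inner_mApp_symm hA.isHermitian, h1]
  simp only [quadForm, mApp_sub_vec, inner_sub_left, inner_sub_right, h1, h2]
  rw [real_inner_comm d g, real_inner_comm g (mApp B⁻¹ g)]
  ring

end BasicLemmas

section ScalarLemmas

/-- one-dimensional averaging argument -/
lemma slope_argument {f df : ℝ → ℝ} {m : ℝ} (hf : ∀ u, HasDerivAt f (df u) u)
    (h : ∀ b ∈ Set.Ico (0 : ℝ) 1, m * (1 - b) ^ 2 ≤ f 1 - f b - df b * (1 - b)) :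
    m ≤ df 1 - (f 1 - f 0) := by
  set k : ℝ → ℝ := fun b => (f 1 - f b) / (1 - b) - m * b with hk
  have hder : ∀ b ∈ Set.Ico (0 : ℝ) 1, HasDerivAt k
      ((f 1 - f b - df b * (1 - b)) / (1 - b) ^ 2 - m) b := by
    intro b hb
    have hb1 : (1 : ℝ) - b ≠ 0 := by linarith [hb.2]
    have h1 : HasDerivAt (fun b => f 1 - f b) (- df b) b := (hf b).const_sub (f 1)
    have h2 : HasDerivAt (fun b : ℝ => 1 - b) (-1) b := (hasDerivAt_id b).const_sub 1
    have h3 := (h1.div h2 hb1).sub ((hasDerivAt_id b).const_mul m)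
    refine h3.congr_deriv ?_
    ring
  have hmono : MonotoneOn k (Set.Ico 0 1) := by
    apply monotoneOn_of_deriv_nonneg (convex_Ico 0 1)
    · intro b hb; exact (hder b hb).continuousAt.continuousWithinAt
    · intro b hb
      exact (hder b (interior_subset hb)).differentiableAt.differentiableWithinAt
    · intro b hb
      have hb' := interior_subset hb
      rw [(hder b hb').deriv, sub_nonneg, le_div_iff₀ (by have := hb'.2; nlinarith [this])]
      exact h b hb'
  have hlim : Filter.Tendsto k (nhdsWithin 1 (Set.Iio 1)) (nhds (df 1 - m * 1)) := by
    have h1 := hasDerivAt_iff_tendsto_slope.mp (hf 1)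
    have h2 : Filter.Tendsto (slope f 1) (nhdsWithin 1 (Set.Iio 1)) (nhds (df 1)) :=
      h1.mono_left (nhdsWithin_mono _ (fun y hy => ne_of_lt hy))
    have h3 : Filter.Tendsto (fun b : ℝ => m * b) (nhdsWithin 1 (Set.Iio 1)) (nhds (m * 1)) :=
      ((continuous_const.mul continuous_id).tendsto 1).mono_left nhdsWithin_le_nhds
    refine (h2.sub h3).congr' ?_
    filter_upwards [self_mem_nhdsWithin] with b hb
    have hb1 : (1 : ℝ) - b ≠ 0 := by have : b < 1 := hb; linarith
    have hb2 : b - (1 : ℝ) ≠ 0 := by have : b < 1 := hb; linarith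
    simp only [hk, slope_def_field]
    rw [← neg_sub (f 1) (f b), ← neg_sub 1 b, neg_div_neg_eq]
  have hge : k 0 ≤ df 1 - m * 1 := by
    refine ge_of_tendsto hlim ?_
    filter_upwards [Ioo_mem_nhdsLT (show (0 : ℝ) < 1 by norm_num)] with b hb
    exact hmono ⟨le_refl _, by norm_num⟩ ⟨hb.1.le, hb.2⟩ hb.1.le
  simp [hk] at hge
  linarith

lemma log_three_ge_one : 1 ≤ Real.log 3 := by
  rw [Real.le_log_iff_exp_le (by norm_num)]
  linarith [Real.exp_one_lt_d9]

lemma one_le_log {t : ℝ} (ht : 3 ≤ t) : 1 ≤ Real.log t :=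
  log_three_ge_one.trans (Real.log_le_log (by norm_num) ht)

/-- `W_s / s` is antitone. -/
lemma W_div_antitone {p x s t : ℝ} (hp : 0 ≤ p) (hx : 0 ≤ x) (hs : 3 ≤ s) (hst : s ≤ t) :
    (p * Real.log t + x) / t ≤ (p * Real.log s + x) / s := by
  have he : Real.exp 1 ≤ 3 := by linarith [Real.exp_one_lt_d9]
  have h1 : Real.log t / t ≤ Real.log s / s :=
    Real.log_div_self_antitoneOn (show Real.exp 1 ≤ s by linarith)
      (show Real.exp 1 ≤ t by linarith) hst
  have h2 : x / t ≤ x / s := by gcongr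
  have h3 := mul_le_mul_of_nonneg_left h1 hp
  rw [add_div, add_div, mul_div_assoc, mul_div_assoc]
  linarith

/-- growth of `W_s` -/
lemma W_growth {p x s t : ℝ} (hp : 0 ≤ p) (hx : 0 ≤ x) (hs : 3 ≤ s) (hst : s ≤ t) :
    p * Real.log t + x ≤ 2 * (p * Real.log s + x) * √(t / s) := by
  have hs0 : 0 < s := by linarith
  have hr : 1 ≤ t / s := by rw [le_div_iff₀ hs0]; linarith
  have h1 : 1 ≤ √(t / s) := Real.one_le_sqrt.mpr hr
  have hl := one_le_log hs
  have h2 : Real.log t = Real.log s + 2 * Real.log √(t / s) := by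
    rw [Real.log_sqrt (by linarith), Real.log_div (by linarith) hs0.ne']; ring
  have h3 := Real.log_le_sub_one_of_pos (show 0 < √(t / s) by linarith)
  have h4 : Real.log t ≤ 2 * Real.log s * √(t / s) := by
    rw [h2]; nlinarith
  have h5 := mul_le_mul_of_nonneg_left h4 hp
  nlinarith

lemma sq_quart {s : ℝ} (hs : 0 ≤ s) : √(√s) ^ 4 = s := by
  calc √(√s) ^ 4 = (√(√s) ^ 2) ^ 2 := by ring
    _ = s := by rw [Real.sq_sqrt (Real.sqrt_nonneg _), Real.sq_sqrt hs]

/-- telescoping bound for `s^(-5/4)` -/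
lemma telescope_quart {s : ℝ} (hs : 1 ≤ s) :
    1 / (√(√s) * s) ≤ 8 * (1 / √(√s) - 1 / √(√(s + 1))) := by
  set A := √(√s) with hA
  set B := √(√(s + 1)) with hB
  have hA4 : A ^ 4 = s := sq_quart (by linarith)
  have hB4 : B ^ 4 = s + 1 := sq_quart (by linarith)
  have hA0 : 0 < A := by rw [hA]; exact Real.sqrt_pos.mpr (Real.sqrt_pos.mpr (by linarith))
  have hAB : A ≤ B := Real.sqrt_le_sqrt (Real.sqrt_le_sqrt (by linarith))
  have hB0 : 0 < B := by linarith
  have h1 : 1 ≤ (B - A) * (4 * B ^ 3) := by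
    have h2 : (B - A) * ((B + A) * (B ^ 2 + A ^ 2)) = 1 := by
      have : (B - A) * ((B + A) * (B ^ 2 + A ^ 2)) = B ^ 4 - A ^ 4 := by ring
      rw [this, hA4, hB4]; ring
    rw [← h2]
    apply mul_le_mul_of_nonneg_left _ (by linarith)
    have h3 : A ^ 2 ≤ B ^ 2 := by gcongr
    nlinarith [mul_nonneg hA0.le (sq_nonneg A), mul_pos hB0 (pow_pos hB0 2), sq_nonneg B]
  have h4 : 1 / A - 1 / B = (B - A) / (A * B) := by field_simp
  have h5 : 1 / (A * (4 * B ^ 4)) ≤ (B - A) / (A * B) := by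
    rw [div_le_div_iff₀ (by positivity) (by positivity)]
    have := mul_le_mul_of_nonneg_left h1 (mul_pos hA0 hB0).le
    nlinarith
  have h6 : 1 / (A * s) ≤ 8 * (1 / (A * (4 * B ^ 4))) := by
    rw [hB4, mul_one_div, div_le_div_iff₀ (by positivity) (by positivity)]
    nlinarith
  rw [h4]; linarith

/-- the term in the cubic sum -/
lemma cubic_term {p x s t : ℝ} (hp : 0 ≤ p) (hx : 0 ≤ x) (hs : 3 ≤ s) (hst : s ≤ t) :
    √(p * Real.log t + x) / (t * √t) ≤
      2 * (√(p * Real.log s + x) / √(√s)) * (8 * (1 / √(√t) - 1 / √(√(t + 1)))) := by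
  have ht0 : 0 < t := by linarith
  have hs0 : 0 < s := by linarith
  have hA0 : 0 < √(√s) := Real.sqrt_pos.mpr (Real.sqrt_pos.mpr hs0)
  have hB0 : 0 < √(√t) := Real.sqrt_pos.mpr (Real.sqrt_pos.mpr ht0)
  have hW0 : 0 ≤ p * Real.log s + x := by
    have := one_le_log hs
    positivity
  have h1 : √(p * Real.log t + x) ≤ 2 * (√(p * Real.log s + x) / √(√s)) * √(√t) := by
    calc √(p * Real.log t + x) ≤ √(2 * (p * Real.log s + x) * √(t / s)) :=
          Real.sqrt_le_sqrt (W_growth hp hx hs hst)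
      _ = √2 * √(p * Real.log s + x) * (√(√t) / √(√s)) := by
          rw [Real.sqrt_mul (by positivity), Real.sqrt_mul (by norm_num), Real.sqrt_div ht0.le,
            Real.sqrt_div (Real.sqrt_nonneg t)]
      _ ≤ 2 * √(p * Real.log s + x) * (√(√t) / √(√s)) := by
          gcongr
          rw [Real.sqrt_le_left (by norm_num)]; norm_num
      _ = _ := by ring
  have h2 := telescope_quart (show 1 ≤ t by linarith)
  have h3 : √t = √(√t) * √(√t) := (Real.mul_self_sqrt (Real.sqrt_nonneg t)).symm
  calc √(p * Real.log t + x) / (t * √t)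
      ≤ 2 * (√(p * Real.log s + x) / √(√s)) * √(√t) / (t * √t) := by gcongr
    _ = 2 * (√(p * Real.log s + x) / √(√s)) * (1 / (√(√t) * t)) := by
        rw [h3]
        simp only [Real.sqrt_mul_self (Real.sqrt_nonneg _)]
        field_simp
    _ ≤ _ := by gcongr

lemma cubic_sum {p x : ℝ} {t₀ : ℕ} (hp : 0 ≤ p) (hx : 0 ≤ x) (hs : (3 : ℝ) ≤ t₀) (n : ℕ) :
    ∑ i ∈ Finset.range n, √(p * Real.log ((t₀ + i : ℕ) : ℝ) + x) /
        (((t₀ + i : ℕ) : ℝ) * √((t₀ + i : ℕ) : ℝ)) ≤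
      16 * √((p * Real.log t₀ + x) / t₀) := by
  have hs0 : (0 : ℝ) < t₀ := by linarith
  have hA0 : 0 < √(√(t₀ : ℝ)) := Real.sqrt_pos.mpr (Real.sqrt_pos.mpr hs0)
  set c := 2 * (√(p * Real.log t₀ + x) / √(√(t₀ : ℝ))) with hc
  have hc0 : 0 ≤ c := by positivity
  have key : ∑ i ∈ Finset.range n, √(p * Real.log ((t₀ + i : ℕ) : ℝ) + x) /
        (((t₀ + i : ℕ) : ℝ) * √((t₀ + i : ℕ) : ℝ)) ≤
      c * (8 * (1 / √(√(t₀ : ℝ)) - 1 / √(√((t₀ + n : ℕ) : ℝ)))) := by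
    induction n with
    | zero => simp
    | succ n ih =>
      rw [Finset.sum_range_succ]
      have h1 := cubic_term (p := p) (x := x) (s := t₀) (t := ((t₀ + n : ℕ) : ℝ)) hp hx hs
        (by push_cast; linarith [Nat.cast_nonneg (α := ℝ) n])
      have h2 : (((t₀ + n : ℕ) : ℝ) + 1) = ((t₀ + (n + 1) : ℕ) : ℝ) := by push_cast; ring
      rw [h2, ← hc] at h1
      calc _ ≤ _ := add_le_add ih h1
        _ = _ := by ring
  refine key.trans ?_
  calc c * (8 * (1 / √(√(t₀ : ℝ)) - 1 / √(√((t₀ + n : ℕ) : ℝ))))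
      ≤ c * (8 * (1 / √(√(t₀ : ℝ)))) := by
        have : 0 ≤ 1 / √(√((t₀ + n : ℕ) : ℝ)) := by positivity
        gcongr; linarith
    _ = 16 * (√(p * Real.log t₀ + x) / (√(√(t₀ : ℝ)) * √(√(t₀ : ℝ)))) := by
        rw [hc]; field_simp; ring
    _ = _ := by
        rw [Real.mul_self_sqrt (Real.sqrt_nonneg _), Real.sqrt_div' _ hs0.le]

lemma inv_sqrt_sum {t₀ : ℕ} (n : ℕ) (h : 1 ≤ t₀) :
    √(t₀ : ℝ) + ∑ i ∈ Finset.range n, 1 / √((t₀ + i : ℕ) : ℝ) ≤ 3 * √((t₀ + n : ℕ) : ℝ) := by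
  induction n with
  | zero => simp; linarith [Real.sqrt_nonneg (t₀ : ℝ)]
  | succ n ih =>
    rw [Finset.sum_range_succ]
    set A := √((t₀ + n : ℕ) : ℝ) with hA
    set B := √((t₀ + (n + 1) : ℕ) : ℝ) with hB
    have hA2 : A ^ 2 = t₀ + n := by rw [hA, Real.sq_sqrt (by positivity)]; push_cast; ring
    have hB2 : B ^ 2 = t₀ + n + 1 := by rw [hB, Real.sq_sqrt (by positivity)]; push_cast; ring
    have h1 : (1 : ℝ) ≤ t₀ := by exact_mod_cast h
    have h0 : (0 : ℝ) ≤ n := Nat.cast_nonneg n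
    have hA1 : 1 ≤ A := by rw [hA]; apply Real.one_le_sqrt.mpr; push_cast; linarith
    have hB0 : 0 ≤ B := Real.sqrt_nonneg _
    have hAB : A ≤ B := by apply Real.sqrt_le_sqrt; push_cast; linarith
    have h2 : 1 / A ≤ 3 * (B - A) := by
      rw [div_le_iff₀ (by linarith)]
      have h3 : (B - A) * (B + A) = 1 := by nlinarith
      have h4 : B ≤ 2 * A := by nlinarith
      nlinarith
    linarith

/-- choice of the warm-start constant -/
lemma warm_start {η M x t : ℝ} {p : ℕ} (hη : 0 < η) (hM : M = 3 + 25 / η ^ 2) (hp : 1 ≤ p)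
    (hx : 0 < x) (ht : M * (p * Real.log (max (p : ℝ) 3) + x) ≤ t) :
    3 ≤ t ∧ (p * Real.log t + x) / t ≤ η := by
  have hM3 : 3 ≤ M := by rw [hM]; have : 0 ≤ 25 / η ^ 2 := by positivity
                         linarith
  have hp1 : (1 : ℝ) ≤ p := by exact_mod_cast hp
  set l := Real.log (max (p : ℝ) 3) with hl
  have hl1 : 1 ≤ l := one_le_log (le_max_right _ _)
  set q := (p : ℝ) * l with hq
  have hq1 : 1 ≤ q := by nlinarith
  have hMq : 3 ≤ M * q := by nlinarith
  have hMqt : M * q ≤ t := by nlinarith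
  have hMx : M * x ≤ t := by nlinarith
  have ht3 : 3 ≤ t := by linarith
  refine ⟨ht3, ?_⟩
  have h1 := W_div_antitone (p := (p : ℝ)) (x := 0) (by linarith) le_rfl hMq hMqt
  simp only [add_zero] at h1
  have hlq : Real.log q ≤ 2 * l := by
    rw [hq, Real.log_mul (by linarith) (by linarith)]
    have h2 : Real.log p ≤ l := Real.log_le_log (by linarith) (le_max_left _ _)
    have h3 := Real.log_le_sub_one_of_pos (show 0 < l by linarith)
    linarith
  have hsM : 1 ≤ √M := Real.one_le_sqrt.mpr (by linarith)
  have hsM2 : √M * √M = M := Real.mul_self_sqrt (by linarith)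
  have hlM : Real.log M ≤ 2 * √M - 2 := by
    have h3 := Real.log_le_sub_one_of_pos (show 0 < √M by linarith)
    rw [Real.log_sqrt (by linarith)] at h3
    linarith
  have h4 : (p : ℝ) * Real.log (M * q) / (M * q) ≤ (Real.log M + 2) / M := by
    rw [Real.log_mul (by linarith) (by linarith), div_le_div_iff₀ (by linarith) (by linarith)]
    have hlM0 : 0 ≤ Real.log M := Real.log_nonneg (by linarith)
    have : (p : ℝ) * (Real.log M + Real.log q) ≤ (Real.log M + 2) * q := by
      rw [hq]
      nlinarith [mul_le_mul_of_nonneg_left hlq (show (0 : ℝ) ≤ p by linarith),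
        mul_nonneg (mul_nonneg (show (0 : ℝ) ≤ p by linarith) hlM0) (sub_nonneg.mpr hl1)]
    nlinarith
  have h5 : x / t ≤ 1 / M := by
    rw [div_le_div_iff₀ (by linarith) (by linarith)]; linarith
  have h6 : (Real.log M + 2) / M + 1 / M ≤ 5 / √M := by
    rw [← add_div, div_le_div_iff₀ (by linarith) (by linarith)]
    nlinarith
  have h7 : 5 / √M ≤ η := by
    rw [div_le_iff₀ (by linarith)]
    have : 5 / η ≤ √M := by
      apply Real.le_sqrt_of_sq_le
      rw [hM, div_pow]; norm_num
    rw [div_le_iff₀ hη] at this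
    linarith
  rw [add_div]
  linarith

end ScalarLemmas

section CurvatureLemma

variable {p : ℕ}

lemma curvature {ℓ : Vec p → ℝ} {grad : Vec p → Vec p} {hess : Vec p → Mat p}
    {θstar y : Vec p} {r L₁ : ℝ} (hL₁ : 0 ≤ L₁)
    (hg : ∀ y, HasGradientAt ℓ (grad y) y)
    (hA2 : ∀ (θ₁ θ₂ : Vec p), ‖θ₁ - θstar‖ ≤ r → ‖θ₂ - θstar‖ ≤ r →
        ∃ φ : ℝ, 0 ≤ φ ∧ φ ≤ L₁ * ‖θ₁ - θ₂‖ ∧ ∃ c ∈ Set.Icc (0 : ℝ) 1,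
          ℓ θ₁ = ℓ θ₂ + ⟪grad θ₂, θ₁ - θ₂⟫
              + (1 / 2) * quadForm (hess (θ₂ + c • (θ₁ - θ₂))) (θ₁ - θ₂) ∧
          ((1 + φ) • hess (θ₂ + c • (θ₁ - θ₂)) - hess θ₁).PosSemidef)
    (hy : ‖y - θstar‖ ≤ r) (hpsd : (hess y).PosSemidef) :
    quadForm (hess y) (y - θstar) / (1 + L₁ * ‖y - θstar‖) ≤
      2 * ⟪grad y, y - θstar⟫ + 2 * (ℓ θstar - ℓ y) := by
  set d := y - θstar with hd
  set m := quadForm (hess y) d / (1 + L₁ * ‖d‖) with hm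
  have hQ := quadForm_nonneg hpsd d
  have hpos : 0 < 1 + L₁ * ‖d‖ := by positivity
  have hder : ∀ u : ℝ, HasDerivAt (fun u : ℝ => ℓ (θstar + u • d))
      (⟪grad (θstar + u • d), d⟫) u := by
    intro u
    have h1 : HasDerivAt (fun u : ℝ => θstar + u • d) d u := by
      simpa using ((hasDerivAt_id u).smul_const d).const_add θstar
    have h2 := (hg (θstar + u • d)).hasFDerivAt.comp_hasDerivAt u h1
    exact h2.congr_deriv (by simp)
  have h := slope_argument (m := m / 2) hder ?_
  · have e1 : θstar + (1 : ℝ) • d = y := by rw [hd]; simp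
    have e0 : θstar + (0 : ℝ) • d = θstar := by simp
    simp only [e1, e0] at h
    linarith
  · intro b hb
    have e1 : θstar + (1 : ℝ) • d = y := by rw [hd]; simp
    simp only [e1]
    set z := θstar + b • d with hz
    have hyz : y - z = (1 - b) • d := by rw [hz, hd, sub_smul, one_smul]; abel
    have hb1 : 0 ≤ 1 - b := by linarith [hb.2]
    have hb2 : 0 < 1 - b := by linarith [hb.2]
    have hzn : ‖z - θstar‖ ≤ r := by
      have : z - θstar = b • d := by rw [hz]; simp
      rw [this, norm_smul, Real.norm_of_nonneg hb.1]
      have := norm_nonneg d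
      nlinarith [hb.1, hb.2]
    obtain ⟨φ, hφ0, hφ, c, hc, hexp, hps⟩ := hA2 y z hy hzn
    have hq := quadForm_nonneg hps d
    rw [quadForm_sub, quadForm_smul_mat] at hq
    rw [hyz] at hexp hφ hq
    rw [quadForm_smul_vec, inner_smul_right] at hexp
    set q := quadForm (hess (z + c • ((1 - b) • d))) d with hqdef
    rw [norm_smul, Real.norm_of_nonneg hb1] at hφ
    have hq0 : 0 ≤ q := by
      by_contra hneg
      push Not at hneg
      nlinarith
    have hφ' : φ ≤ L₁ * ‖d‖ := by
      have : (1 - b) * ‖d‖ ≤ ‖d‖ := by nlinarith [norm_nonneg d, hb.1]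
      nlinarith
    have hmq : m ≤ q := by
      rw [hm, div_le_iff₀ hpos]
      nlinarith
    have := mul_le_mul_of_nonneg_right hmq (sq_nonneg (1 - b))
    rw [hexp]
    nlinarith

end CurvatureLemma

section MainArgument

/-- The standing assumptions for `p ≥ 1`, with the warm-start length already translated. -/
structure Setup (K₁ K₂ K₃ K₄ K₅ L₁ L₂ L₃ lamBar0 C₀ r : ℝ) (p : ℕ) (x : ℝ) (θstar : Vec p)
    (ℓ : ℕ → Vec p → ℝ) (grad : ℕ → Vec p → Vec p) (hess : ℕ → Vec p → Mat p)
    (t₀ : ℕ) (Ω₀ : Mat p) (θ : ℕ → Vec p) (Ω : ℕ → Mat p) : Prop where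
  hp : 1 ≤ p
  ht₀ : (3 : ℝ) ≤ t₀
  hK₂ : 0 < K₂
  hK₃ : 0 < K₃
  hK₄ : 0 < K₄
  hK₅ : 0 < K₅
  hL₁ : 0 ≤ L₁
  hL₂ : 0 < L₂
  hL₃ : 0 < L₃
  hlam : 0 < lamBar0
  hC₀ : 0 < C₀
  hr : 0 < r
  hx : 0 < x
  hgrad : ∀ t y, HasGradientAt (ℓ t) (grad t y) y
  hhess : ∀ t y, HasFDerivAt (grad t)
        (LinearMap.toContinuousLinearMap (Matrix.toEuclideanLin (hess t y))) y
  hΩ₀ : Ω₀.PosDef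
  hΩ₀le : ∀ v : Vec p, quadForm Ω₀ v ≤ lamBar0 * ‖v‖ ^ 2
  hΩt₀ : Ω t₀ = Ω₀ + ∑ s ∈ Finset.Icc 1 t₀, hess s (θ t₀)
  hΩ : ∀ t, t₀ < t → Ω t = Ω (t - 1) + hess t (θ (t - 1))
  hθ : ∀ t, t₀ < t → θ t = θ (t - 1) - mApp (Ω t)⁻¹ (grad t (θ (t - 1)))
  hpsd : ∀ t, t₀ < t → (hess t (θ (t - 1))).PosSemidef
  hA1 : ∀ t : ℕ, K₁ * (p + x) ≤ (t : ℝ) → ∀ θbar : ℕ → Vec p,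
        (∀ s ∈ Finset.Icc 1 t, ‖θbar s - θstar‖ ≤ r) →
        ∀ v : Vec p, K₂ * t * ‖v‖ ^ 2 ≤
          quadForm (∑ s ∈ Finset.Icc 1 t, hess s (θbar s)) v
  hA2 : ∀ (t : ℕ) (θ₁ θ₂ : Vec p), ‖θ₁ - θstar‖ ≤ r → ‖θ₂ - θstar‖ ≤ r →
        ∃ φ : ℝ, 0 ≤ φ ∧ φ ≤ L₁ * ‖θ₁ - θ₂‖ ∧ ∃ c ∈ Set.Icc (0 : ℝ) 1,
          ℓ t θ₁ = ℓ t θ₂ + ⟪grad t θ₂, θ₁ - θ₂⟫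
              + (1 / 2) * quadForm (hess t (θ₂ + c • (θ₁ - θ₂))) (θ₁ - θ₂) ∧
          ((1 + φ) • hess t (θ₂ + c • (θ₁ - θ₂)) - hess t θ₁).PosSemidef
  hA2n : ∀ (t : ℕ) (y : Vec p), ‖y - θstar‖ ≤ r → specNorm (hess t y) ≤ L₂
  hA3 : ∀ (t : ℕ) (y y' : Vec p), ‖y - θstar‖ ≤ r → ‖y' - θstar‖ ≤ r →
        specNorm (hess t y - hess t y') ≤ L₃ * ‖y - y'‖
  hA4 : K₁ * (p + x) ≤ (t₀ : ℝ)
  hA4l : ∀ t : ℕ, t₀ < t →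
        ∑ s ∈ Finset.Icc (t₀ + 1) t, (ℓ s θstar - ℓ s (θ (s - 1))) ≤ K₃ * x
  hA4g : ∀ t : ℕ, t₀ < t → (t : ℕ∞) ≤ texit θstar r t₀ θ →
        ∑ s ∈ Finset.Icc (t₀ + 1) t, quadForm (Ω s)⁻¹ (grad s (θ (s - 1)))
          ≤ K₄ * p * Real.log t + K₅ * (x + Real.log t)
  hA5 : ‖θ t₀ - θstar‖ ≤ r
  hA5v : quadForm (Ω t₀) (θ t₀ - θstar) ≤ C₀ * (p + x)

variable {K₁ K₂ K₃ K₄ K₅ L₁ L₂ L₃ lamBar0 C₀ r : ℝ} {p : ℕ} {x : ℝ} {θstar : Vec p}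
    {ℓ : ℕ → Vec p → ℝ} {grad : ℕ → Vec p → Vec p} {hess : ℕ → Vec p → Mat p}
    {t₀ : ℕ} {Ω₀ : Mat p} {θ : ℕ → Vec p} {Ω : ℕ → Mat p}

/-- evaluation points of the Hessians in `Ω_t` -/
def evalPt {p : ℕ} (t₀ : ℕ) (θ : ℕ → Vec p) (s : ℕ) : Vec p :=
  if s ≤ t₀ then θ t₀ else θ (s - 1)

lemma sum_shift (f : ℕ → ℝ) (t₀ n : ℕ) :
    ∑ s ∈ Finset.Icc (t₀ + 1) (t₀ + n), f (s - 1) = ∑ i ∈ Finset.range n, f (t₀ + i) := by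
  induction n with
  | zero => simp
  | succ n ih =>
    rw [Finset.sum_range_succ, ← ih, ← add_assoc, Finset.sum_Icc_succ_top (by omega)]
    simp

namespace Setup

lemma t₀_pos (h : Setup K₁ K₂ K₃ K₄ K₅ L₁ L₂ L₃ lamBar0 C₀ r p x θstar ℓ grad hess t₀ Ω₀ θ Ω) :
    3 ≤ t₀ := by exact_mod_cast h.ht₀

lemma Omega_eq
    (h : Setup K₁ K₂ K₃ K₄ K₅ L₁ L₂ L₃ lamBar0 C₀ r p x θstar ℓ grad hess t₀ Ω₀ θ Ω)
    (t : ℕ) (ht : t₀ ≤ t) :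
    Ω t = Ω₀ + ∑ s ∈ Finset.Icc 1 t, hess s (evalPt t₀ θ s) := by
  induction t, ht using Nat.le_induction with
  | base =>
    rw [h.hΩt₀]
    congr 1
    refine Finset.sum_congr rfl fun s hs => ?_
    rw [evalPt, if_pos (Finset.mem_Icc.mp hs).2]
  | succ t ht ih =>
    rw [h.hΩ (t + 1) (by omega), Finset.sum_Icc_succ_top (by omega), Nat.add_sub_cancel, ih,
      add_assoc]
    have : evalPt t₀ θ (t + 1) = θ t := by
      rw [evalPt, if_neg (by omega), Nat.add_sub_cancel]
    rw [this]

lemma hess_herm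
    (h : Setup K₁ K₂ K₃ K₄ K₅ L₁ L₂ L₃ lamBar0 C₀ r p x θstar ℓ grad hess t₀ Ω₀ θ Ω)
    (t : ℕ) (y : Vec p) : (hess t y).IsHermitian := hess_symm (h.hgrad t) (h.hhess t y)

lemma sum_herm
    (h : Setup K₁ K₂ K₃ K₄ K₅ L₁ L₂ L₃ lamBar0 C₀ r p x θstar ℓ grad hess t₀ Ω₀ θ Ω)
    (S : Finset ℕ) (f : ℕ → Vec p) : (∑ s ∈ S, hess s (f s)).IsHermitian := by
  rw [Matrix.IsHermitian, Matrix.conjTranspose_sum]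
  exact Finset.sum_congr rfl fun s _ => h.hess_herm s (f s)

lemma evalPt_mem
    (h : Setup K₁ K₂ K₃ K₄ K₅ L₁ L₂ L₃ lamBar0 C₀ r p x θstar ℓ grad hess t₀ Ω₀ θ Ω)
    {t : ℕ} (hin : ∀ s, t₀ ≤ s → s < t → ‖θ s - θstar‖ ≤ r) (s : ℕ) (hs : s ≤ t) :
    ‖evalPt t₀ θ s - θstar‖ ≤ r := by
  unfold evalPt
  split_ifs with h1
  · exact h.hA5
  · exact hin _ (by omega) (by omega)

lemma Omega_lower
    (h : Setup K₁ K₂ K₃ K₄ K₅ L₁ L₂ L₃ lamBar0 C₀ r p x θstar ℓ grad hess t₀ Ω₀ θ Ω)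
    {t : ℕ} (ht : t₀ ≤ t) (hin : ∀ s, t₀ ≤ s → s < t → ‖θ s - θstar‖ ≤ r) (v : Vec p) :
    K₂ * t * ‖v‖ ^ 2 ≤ quadForm (Ω t) v := by
  rw [h.Omega_eq t ht, quadForm_add]
  have h1 := quadForm_nonneg h.hΩ₀.posSemidef v
  have htt : (t₀ : ℝ) ≤ t := by exact_mod_cast ht
  have h2 := h.hA1 t (h.hA4.trans htt) (evalPt t₀ θ)
    (fun s hs => h.evalPt_mem hin s (Finset.mem_Icc.mp hs).2) v
  linarith

lemma cast_pos
    (h : Setup K₁ K₂ K₃ K₄ K₅ L₁ L₂ L₃ lamBar0 C₀ r p x θstar ℓ grad hess t₀ Ω₀ θ Ω)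
    {t : ℕ} (ht : t₀ ≤ t) : (3 : ℝ) ≤ t :=
  h.ht₀.trans (by exact_mod_cast ht)

lemma Omega_posDef
    (h : Setup K₁ K₂ K₃ K₄ K₅ L₁ L₂ L₃ lamBar0 C₀ r p x θstar ℓ grad hess t₀ Ω₀ θ Ω)
    {t : ℕ} (ht : t₀ ≤ t) (hin : ∀ s, t₀ ≤ s → s < t → ‖θ s - θstar‖ ≤ r) : (Ω t).PosDef := by
  have h3 := h.cast_pos ht
  refine posDef_of_quadForm ?_ (mul_pos h.hK₂ (show (0 : ℝ) < t by linarith))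
    (h.Omega_lower ht hin)
  rw [h.Omega_eq t ht]
  exact h.hΩ₀.isHermitian.add (h.sum_herm _ _)

/-- the one-step inequality -/
lemma step
    (h : Setup K₁ K₂ K₃ K₄ K₅ L₁ L₂ L₃ lamBar0 C₀ r p x θstar ℓ grad hess t₀ Ω₀ θ Ω)
    {t : ℕ} (ht : t₀ ≤ t) (hin : ∀ s, t₀ ≤ s → s < t + 1 → ‖θ s - θstar‖ ≤ r) :
    quadForm (Ω (t + 1)) (θ (t + 1) - θstar) ≤ quadForm (Ω t) (θ t - θstar)
      + (2 * (ℓ (t + 1) θstar - ℓ (t + 1) (θ t)) + quadForm (Ω (t + 1))⁻¹ (grad (t + 1) (θ t))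
        + L₁ * L₂ * ‖θ t - θstar‖ ^ 3) := by
  have hpd := h.Omega_posDef (t := t + 1) (by omega) hin
  have hO := h.hΩ (t + 1) (by omega)
  have hT := h.hθ (t + 1) (by omega)
  have hP := h.hpsd (t + 1) (by omega)
  rw [Nat.add_sub_cancel] at hO hT hP
  have hd : ‖θ t - θstar‖ ≤ r := hin t ht (by omega)
  have hc := curvature h.hL₁ (h.hgrad (t + 1)) (h.hA2 (t + 1)) hd hP
  have hid : quadForm (Ω (t + 1)) (θ (t + 1) - θstar) =
      quadForm (Ω t) (θ t - θstar) + quadForm (hess (t + 1) (θ t)) (θ t - θstar)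
        - 2 * ⟪grad (t + 1) (θ t), θ t - θstar⟫
        + quadForm (Ω (t + 1))⁻¹ (grad (t + 1) (θ t)) := by
    rw [hT, sub_right_comm, hO]
    rw [hO] at hpd
    exact step_identity hpd
  rw [hid]
  have hQ := quadForm_nonneg hP (θ t - θstar)
  have hQ2 := quadForm_le_specNorm (hess (t + 1) (θ t)) (θ t - θstar)
  have hS := h.hA2n (t + 1) (θ t) hd
  set Q := quadForm (hess (t + 1) (θ t)) (θ t - θstar)
  set δ := ‖θ t - θstar‖
  have hδ : 0 ≤ δ := norm_nonneg _
  have hLδ : 0 ≤ L₁ * δ := mul_nonneg h.hL₁ hδ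
  have h1 : Q - L₁ * δ * Q ≤ Q / (1 + L₁ * δ) := by
    rw [le_div_iff₀ (by linarith)]
    nlinarith [mul_nonneg hQ (mul_nonneg hLδ hLδ)]
  have h2 : Q ≤ L₂ * δ ^ 2 := hQ2.trans (by gcongr)
  have h3 : L₁ * δ * Q ≤ L₁ * L₂ * δ ^ 3 := by
    calc L₁ * δ * Q ≤ L₁ * δ * (L₂ * δ ^ 2) := by gcongr
      _ = _ := by ring
  linarith

lemma telescoped
    (h : Setup K₁ K₂ K₃ K₄ K₅ L₁ L₂ L₃ lamBar0 C₀ r p x θstar ℓ grad hess t₀ Ω₀ θ Ω)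
    {t : ℕ} (ht : t₀ ≤ t) (hin : ∀ s, t₀ ≤ s → s < t → ‖θ s - θstar‖ ≤ r) :
    quadForm (Ω t) (θ t - θstar) ≤ quadForm (Ω t₀) (θ t₀ - θstar)
      + (2 * ∑ s ∈ Finset.Icc (t₀ + 1) t, (ℓ s θstar - ℓ s (θ (s - 1)))
      + ∑ s ∈ Finset.Icc (t₀ + 1) t, quadForm (Ω s)⁻¹ (grad s (θ (s - 1)))
      + L₁ * L₂ * ∑ s ∈ Finset.Icc (t₀ + 1) t, ‖θ (s - 1) - θstar‖ ^ 3) := by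
  induction t, ht using Nat.le_induction with
  | base => simp
  | succ t ht ih =>
    have h1 := ih fun s hs hs' => hin s hs (by omega)
    have h2 := h.step ht hin
    simp only [Finset.sum_Icc_succ_top (show t₀ + 1 ≤ t + 1 by omega), Nat.add_sub_cancel]
    linarith

lemma le_texit {t : ℕ} (hin : ∀ s, t₀ ≤ s → s < t → ‖θ s - θstar‖ ≤ r) :
    (t : ℕ∞) ≤ texit θstar r t₀ θ := by
  refine le_sInf ?_
  rintro n ⟨s, rfl, hs, hs'⟩
  by_contra hlt
  push Not at hlt
  have : s < t := by exact_mod_cast hlt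
  linarith [hin s hs.le this]

lemma W_pos
    (h : Setup K₁ K₂ K₃ K₄ K₅ L₁ L₂ L₃ lamBar0 C₀ r p x θstar ℓ grad hess t₀ Ω₀ θ Ω)
    {t : ℕ} (ht : t₀ ≤ t) : 1 ≤ (p : ℝ) * Real.log t + x := by
  have h1 := one_le_log (h.cast_pos ht)
  have h2 : (1 : ℝ) ≤ p := by exact_mod_cast h.hp
  nlinarith [h.hx]

lemma W_mono
    (h : Setup K₁ K₂ K₃ K₄ K₅ L₁ L₂ L₃ lamBar0 C₀ r p x θstar ℓ grad hess t₀ Ω₀ θ Ω)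
    {s t : ℕ} (hs : t₀ ≤ s) (hst : s ≤ t) :
    (p : ℝ) * Real.log s + x ≤ (p : ℝ) * Real.log t + x := by
  have h1 := h.cast_pos hs
  have : Real.log s ≤ Real.log t := Real.log_le_log (by linarith) (by exact_mod_cast hst)
  gcongr

lemma norm_bound
    (h : Setup K₁ K₂ K₃ K₄ K₅ L₁ L₂ L₃ lamBar0 C₀ r p x θstar ℓ grad hess t₀ Ω₀ θ Ω)
    {D : ℝ} {t : ℕ} (ht : t₀ ≤ t) (hD : 0 ≤ D)
    (hin : ∀ s, t₀ ≤ s → s < t → ‖θ s - θstar‖ ≤ r)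
    (hV : quadForm (Ω t) (θ t - θstar) ≤ D * ((p : ℝ) * Real.log t + x)) :
    ‖θ t - θstar‖ ≤ √(D / K₂) * √(((p : ℝ) * Real.log t + x) / t) := by
  have h1 := h.Omega_lower ht hin (θ t - θstar)
  have h2 := h.cast_pos ht
  have hK := h.hK₂
  rw [← Real.sqrt_mul (by positivity)]
  apply Real.le_sqrt_of_sq_le
  rw [div_mul_div_comm, le_div_iff₀ (mul_pos hK (by linarith))]
  linarith

/-- the main bootstrap -/
lemma bootstrap
    (h : Setup K₁ K₂ K₃ K₄ K₅ L₁ L₂ L₃ lamBar0 C₀ r p x θstar ℓ grad hess t₀ Ω₀ θ Ω)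
    {C e : ℝ} (hC : C = C₀ + 2 * K₃ + K₄ + K₅)
    (he : √(((p : ℝ) * Real.log t₀ + x) / t₀) ≤ e)
    (he1 : L₁ * L₂ * √(2 * C / K₂) ^ 3 * (16 * e) ≤ C)
    (he2 : √(2 * C / K₂) * e ≤ r) (t : ℕ) (ht : t₀ ≤ t) :
    ‖θ t - θstar‖ ≤ r ∧
      quadForm (Ω t) (θ t - θstar) ≤ 2 * C * ((p : ℝ) * Real.log t + x) := by
  induction t using Nat.strong_induction_on with
  | _ t ih =>
  have hC₀ := h.hC₀
  have hK₃ := h.hK₃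
  have hK₄ := h.hK₄
  have hK₅ := h.hK₅
  have hK₂ := h.hK₂
  have hx := h.hx
  have hL : 0 ≤ L₁ * L₂ := mul_nonneg h.hL₁ h.hL₂.le
  have hCp : 0 < C := by rw [hC]; positivity
  have hp1 : (1 : ℝ) ≤ p := by exact_mod_cast h.hp
  have hin : ∀ s, t₀ ≤ s → s < t → ‖θ s - θstar‖ ≤ r := fun s hs hst => (ih s hst hs).1
  have hW := h.W_pos ht
  have ht3 := h.cast_pos ht
  have hlog := one_le_log ht3
  have hV : quadForm (Ω t) (θ t - θstar) ≤ 2 * C * ((p : ℝ) * Real.log t + x) := by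
    rcases ht.eq_or_lt with heq | hlt
    · subst heq
      refine h.hA5v.trans ?_
      calc C₀ * (p + x) ≤ C₀ * ((p : ℝ) * Real.log t₀ + x) := by gcongr; nlinarith
        _ ≤ 2 * C * ((p : ℝ) * Real.log t₀ + x) := by
          gcongr; linarith
    · have h1 := h.telescoped ht hin
      have h2 := h.hA4l t hlt
      have h3 := h.hA4g t hlt (le_texit hin)
      have h4 := h.hA5v
      have h5 : ∑ s ∈ Finset.Icc (t₀ + 1) t, ‖θ (s - 1) - θstar‖ ^ 3 ≤
          √(2 * C / K₂) ^ 3 * ((p : ℝ) * Real.log t + x) * (16 * e) := by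
        obtain ⟨n, rfl⟩ := Nat.exists_eq_add_of_le ht
        rw [sum_shift (fun s => ‖θ s - θstar‖ ^ 3) t₀ n]
        calc ∑ i ∈ Finset.range n, ‖θ (t₀ + i) - θstar‖ ^ 3
            ≤ ∑ i ∈ Finset.range n, √(2 * C / K₂) ^ 3 *
                ((p : ℝ) * Real.log ((t₀ + n : ℕ) : ℝ) + x) *
                (√(p * Real.log ((t₀ + i : ℕ) : ℝ) + x) /
                  (((t₀ + i : ℕ) : ℝ) * √((t₀ + i : ℕ) : ℝ))) := by
              refine Finset.sum_le_sum fun i hi => ?_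
              have hi' : i < n := Finset.mem_range.mp hi
              have hs : t₀ ≤ t₀ + i := by omega
              have hb := h.norm_bound hs (D := 2 * C) (by positivity)
                (fun s hs hst => hin s hs (by omega)) (ih (t₀ + i) (by omega) hs).2
              have hs3 := h.cast_pos hs
              have hW' := h.W_pos hs
              have hWm := h.W_mono hs (show t₀ + i ≤ t₀ + n by omega)
              set s : ℝ := ((t₀ + i : ℕ) : ℝ)
              set w := (p : ℝ) * Real.log s + x
              set w' := (p : ℝ) * Real.log ((t₀ + n : ℕ) : ℝ) + x
              calc ‖θ (t₀ + i) - θstar‖ ^ 3 ≤ (√(2 * C / K₂) * √(w / s)) ^ 3 := by gcongr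
                _ = √(2 * C / K₂) ^ 3 * (w * (√w / (s * √s))) := by
                    rw [Real.sqrt_div' _ (by linarith : (0 : ℝ) ≤ s)]
                    have e1 : √w ^ 2 = w := Real.sq_sqrt (by linarith)
                    have e2 : √s ^ 2 = s := Real.sq_sqrt (by linarith)
                    rw [mul_pow, div_pow]
                    congr 1
                    rw [pow_succ, pow_succ √s 2, e1, e2, mul_div_assoc]
                _ ≤ √(2 * C / K₂) ^ 3 * (w' * (√w / (s * √s))) := by gcongr
                _ = _ := by ring
          _ = √(2 * C / K₂) ^ 3 * ((p : ℝ) * Real.log ((t₀ + n : ℕ) : ℝ) + x) *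
              ∑ i ∈ Finset.range n, (√(p * Real.log ((t₀ + i : ℕ) : ℝ) + x) /
                  (((t₀ + i : ℕ) : ℝ) * √((t₀ + i : ℕ) : ℝ))) := by rw [Finset.mul_sum]
          _ ≤ _ := by
              have hcs := cubic_sum (p := p) (x := x) (by linarith) hx.le h.ht₀ n
              gcongr
              exact hcs.trans (by gcongr)
      have h6 : L₁ * L₂ * ∑ s ∈ Finset.Icc (t₀ + 1) t, ‖θ (s - 1) - θstar‖ ^ 3 ≤
          C * ((p : ℝ) * Real.log t + x) := by
        calc _ ≤ L₁ * L₂ * (√(2 * C / K₂) ^ 3 * ((p : ℝ) * Real.log t + x) * (16 * e)) := by gcongr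
          _ = (L₁ * L₂ * √(2 * C / K₂) ^ 3 * (16 * e)) * ((p : ℝ) * Real.log t + x) := by ring
          _ ≤ _ := by gcongr
      have hpl : Real.log t ≤ p * Real.log t := by nlinarith
      have hpp : (p : ℝ) ≤ p * Real.log t := by nlinarith
      have h7 : C₀ * (p + x) + 2 * (K₃ * x) + (K₄ * p * Real.log t + K₅ * (x + Real.log t)) ≤
          C * ((p : ℝ) * Real.log t + x) := by
        rw [hC]
        have a1 : C₀ * (p + x) ≤ C₀ * ((p : ℝ) * Real.log t + x) := by gcongr
        have a2 : K₃ * x ≤ K₃ * ((p : ℝ) * Real.log t + x) := by gcongr; linarith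
        have a3 : K₄ * (p * Real.log t) ≤ K₄ * ((p : ℝ) * Real.log t + x) := by gcongr; linarith
        have a4 : K₅ * (x + Real.log t) ≤ K₅ * ((p : ℝ) * Real.log t + x) :=
          mul_le_mul_of_nonneg_left (by linarith) hK₅.le
        linarith
      linarith
  refine ⟨?_, hV⟩
  refine (h.norm_bound ht (by positivity) hin hV).trans (le_trans ?_ he2)
  gcongr
  refine le_trans (Real.sqrt_le_sqrt ?_) he
  exact W_div_antitone (by linarith) hx.le h.ht₀ (by exact_mod_cast ht)

/-- bound on the difference of the two matrices -/
lemma diff_bound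
    (h : Setup K₁ K₂ K₃ K₄ K₅ L₁ L₂ L₃ lamBar0 C₀ r p x θstar ℓ grad hess t₀ Ω₀ θ Ω)
    {κ : ℝ} (hκ : 0 ≤ κ) (hin : ∀ s, t₀ ≤ s → ‖θ s - θstar‖ ≤ r)
    (hb : ∀ s, t₀ ≤ s → ‖θ s - θstar‖ ≤ κ * √(((p : ℝ) * Real.log s + x) / s))
    (t : ℕ) (ht : t₀ ≤ t) :
    specNorm (Ω t - Fmat hess t θstar) ≤
      lamBar0 + 3 * L₃ * κ * (√((p : ℝ) * Real.log t + x) * √(t : ℝ)) := by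
  have e1 : Ω t - Fmat hess t θstar =
      Ω₀ + ∑ s ∈ Finset.Icc 1 t, (hess s (evalPt t₀ θ s) - hess s θstar) := by
    rw [h.Omega_eq t ht, Fmat, Finset.sum_sub_distrib, add_sub_assoc]
  rw [e1]
  have h0 := specNorm_le_of_quadForm h.hΩ₀.posSemidef h.hlam.le h.hΩ₀le
  have h1 := specNorm_add_le Ω₀ (∑ s ∈ Finset.Icc 1 t, (hess s (evalPt t₀ θ s) - hess s θstar))
  have h2 := specNorm_sum_le (Finset.Icc 1 t) (fun s => hess s (evalPt t₀ θ s) - hess s θstar)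
  have h3 : ∑ s ∈ Finset.Icc 1 t, specNorm (hess s (evalPt t₀ θ s) - hess s θstar) ≤
      ∑ s ∈ Finset.Icc 1 t, L₃ * ‖evalPt t₀ θ s - θstar‖ := by
    refine Finset.sum_le_sum fun s hs => ?_
    refine h.hA3 s _ _ (h.evalPt_mem (t := t) (fun s hs _ => hin s hs) s (Finset.mem_Icc.mp hs).2) ?_
    simp [h.hr.le]
  obtain ⟨n, rfl⟩ := Nat.exists_eq_add_of_le ht
  have h4 : ∀ m, ∑ s ∈ Finset.Icc 1 (t₀ + m), L₃ * ‖evalPt t₀ θ s - θstar‖ =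
      L₃ * (t₀ * ‖θ t₀ - θstar‖ + ∑ i ∈ Finset.range m, ‖θ (t₀ + i) - θstar‖) := by
    intro m
    induction m with
    | zero =>
      rw [← Finset.mul_sum]
      have : ∀ s ∈ Finset.Icc 1 (t₀ + 0), ‖evalPt t₀ θ s - θstar‖ = ‖θ t₀ - θstar‖ := by
        intro s hs
        rw [evalPt, if_pos (by simpa using (Finset.mem_Icc.mp hs).2)]
      rw [Finset.sum_congr rfl this]
      simp
    | succ m ihm =>
      rw [← add_assoc, Finset.sum_Icc_succ_top (by omega), ihm, Finset.sum_range_succ]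
      have : evalPt t₀ θ (t₀ + m + 1) = θ (t₀ + m) := by
        rw [evalPt, if_neg (by omega), Nat.add_sub_cancel]
      rw [this]; ring
  rw [h4 n] at h3
  set w := √((p : ℝ) * Real.log ((t₀ + n : ℕ) : ℝ) + x) with hw
  have hb' : ∀ i ≤ n, ‖θ (t₀ + i) - θstar‖ ≤ κ * w * (1 / √((t₀ + i : ℕ) : ℝ)) := by
    intro i hi
    refine (hb (t₀ + i) (by omega)).trans ?_
    have hs3 := h.cast_pos (show t₀ ≤ t₀ + i by omega)
    rw [Real.sqrt_div' _ (by linarith), mul_assoc, mul_one_div]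
    have := h.W_mono (show t₀ ≤ t₀ + i by omega) (show t₀ + i ≤ t₀ + n by omega)
    gcongr
    exact Real.sqrt_le_sqrt this
  have h5 : ∑ i ∈ Finset.range n, ‖θ (t₀ + i) - θstar‖ ≤
      κ * w * ∑ i ∈ Finset.range n, 1 / √((t₀ + i : ℕ) : ℝ) := by
    rw [Finset.mul_sum]
    exact Finset.sum_le_sum fun i hi => hb' i (Finset.mem_range.mp hi).le
  have h6 : t₀ * ‖θ t₀ - θstar‖ ≤ κ * w * √(t₀ : ℝ) := by
    have := hb' 0 (Nat.zero_le _)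
    simp only [add_zero] at this
    have ht0 : (0 : ℝ) < t₀ := by linarith [h.ht₀]
    calc t₀ * ‖θ t₀ - θstar‖ ≤ t₀ * (κ * w * (1 / √(t₀ : ℝ))) := by gcongr
      _ = κ * w * (t₀ / √(t₀ : ℝ)) := by ring
      _ = _ := by rw [Real.div_sqrt]
  have h7 := inv_sqrt_sum n (show 1 ≤ t₀ by have := h.t₀_pos; omega)
  have hκw : 0 ≤ κ * w := by positivity
  have h8 := mul_le_mul_of_nonneg_left h7 hκw
  have h9 : L₃ * (t₀ * ‖θ t₀ - θstar‖ + ∑ i ∈ Finset.range n, ‖θ (t₀ + i) - θstar‖) ≤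
      L₃ * (κ * w * (3 * √((t₀ + n : ℕ) : ℝ))) := by
    have := h.hL₃
    gcongr
    linarith
  linarith

end Setup

end MainArgument

/-- The constant `κ` in the bound for `‖θ_t - θ⋆‖`. -/
def kapConst (K₂ K₃ K₄ K₅ C₀ : ℝ) : ℝ := √(2 * (C₀ + 2 * K₃ + K₄ + K₅) / K₂)

/-- The smallness constant for the warm start. -/
def radConst (K₂ K₃ K₄ K₅ L₁ L₂ C₀ r : ℝ) : ℝ :=
  min ((C₀ + 2 * K₃ + K₄ + K₅) / (16 * (L₁ * L₂ * kapConst K₂ K₃ K₄ K₅ C₀ ^ 3) + 1))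
    (r / kapConst K₂ K₃ K₄ K₅ C₀)

set_option maxHeartbeats 1000000 in
/-- precision accuracy (Proposition 2 of the paper).
Since the positive semidefinite square root of a positive definite matrix is
unique, `Ω_t^{−1/2}` (resp. `F_{t,θ⋆}^{−1/2}`) is encoded by quantifying over
all positive semidefinite `S` with `S * S = (Ω t)⁻¹` (resp. `= F_{t,θ⋆}⁻¹`).
Dependencies: `M = M(K₁,…,K₅, L₁, L₂, C₀, r)` and
`K = K(K₂, K₃, K₄, K₅, L₃, λ̄₀, C₀)`, encoded as functions of exactly these
arguments. -/
theorem stmt8 :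
    ∃ M : ℝ → ℝ → ℝ → ℝ → ℝ → ℝ → ℝ → ℝ → ℝ → ℝ,
    ∃ K : ℝ → ℝ → ℝ → ℝ → ℝ → ℝ → ℝ → ℝ,
    (∀ K₁ K₂ K₃ K₄ K₅ L₁ L₂ C₀ r : ℝ,
      0 < K₁ → 0 < K₂ → 0 < K₃ → 0 < K₄ → 0 < K₅ →
      0 ≤ L₁ → 0 < L₂ → 0 < C₀ → 0 < r →
      0 < M K₁ K₂ K₃ K₄ K₅ L₁ L₂ C₀ r) ∧
    (∀ K₂ K₃ K₄ K₅ L₃ lamBar0 C₀ : ℝ,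
      0 < K₂ → 0 < K₃ → 0 < K₄ → 0 < K₅ → 0 < L₃ → 0 < lamBar0 → 0 < C₀ →
      0 < K K₂ K₃ K₄ K₅ L₃ lamBar0 C₀) ∧
    ∀ K₁ K₂ K₃ K₄ K₅ L₁ L₂ L₃ lamBar0 C₀ r : ℝ,
      0 < K₁ → 0 < K₂ → 0 < K₃ → 0 < K₄ → 0 < K₅ →
      0 ≤ L₁ → 0 < L₂ → 0 < L₃ → 0 < lamBar0 → 0 < C₀ → 0 < r →
    ∀ (p : ℕ) (x : ℝ) (θstar : Vec p) (ℓ : ℕ → Vec p → ℝ)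
      (grad : ℕ → Vec p → Vec p) (hess : ℕ → Vec p → Mat p)
      (t₀ : ℕ) (Ω₀ : Mat p) (θ : ℕ → Vec p) (Ω : ℕ → Mat p),
      0 < x →
      -- ℓ_t is C² with gradient `grad` and Hessian `hess`
      (∀ t y, HasGradientAt (ℓ t) (grad t y) y) →
      (∀ t y, HasFDerivAt (grad t)
        (LinearMap.toContinuousLinearMap (Matrix.toEuclideanLin (hess t y))) y) →
      (∀ t, Continuous (hess t)) →
      -- algorithm
      Ω₀.PosDef →
      (∀ v : Vec p, quadForm Ω₀ v ≤ lamBar0 * ‖v‖ ^ 2) →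
      Ω t₀ = Ω₀ + ∑ s ∈ Finset.Icc 1 t₀, hess s (θ t₀) →
      (∀ t, t₀ < t → Ω t = Ω (t - 1) + hess t (θ (t - 1))) →
      (∀ t, t₀ < t → θ t = θ (t - 1) - mApp (Ω t)⁻¹ (grad t (θ (t - 1)))) →
      (∀ t, t₀ < t → (hess t (θ (t - 1))).PosSemidef) →
      -- (A1)
      (∀ t : ℕ, K₁ * (p + x) ≤ (t : ℝ) → ∀ θbar : ℕ → Vec p,
        (∀ s ∈ Finset.Icc 1 t, ‖θbar s - θstar‖ ≤ r) →
        ∀ v : Vec p, K₂ * t * ‖v‖ ^ 2 ≤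
          quadForm (∑ s ∈ Finset.Icc 1 t, hess s (θbar s)) v) →
      -- (A2)
      (∀ (t : ℕ) (θ₁ θ₂ : Vec p), ‖θ₁ - θstar‖ ≤ r → ‖θ₂ - θstar‖ ≤ r →
        ∃ φ : ℝ, 0 ≤ φ ∧ φ ≤ L₁ * ‖θ₁ - θ₂‖ ∧ ∃ c ∈ Set.Icc (0 : ℝ) 1,
          ℓ t θ₁ = ℓ t θ₂ + ⟪grad t θ₂, θ₁ - θ₂⟫
              + (1 / 2) * quadForm (hess t (θ₂ + c • (θ₁ - θ₂))) (θ₁ - θ₂) ∧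
          ((1 + φ) • hess t (θ₂ + c • (θ₁ - θ₂)) - hess t θ₁).PosSemidef) →
      (∀ (t : ℕ) (y : Vec p), ‖y - θstar‖ ≤ r → specNorm (hess t y) ≤ L₂) →
      -- (A3)
      (∀ (t : ℕ) (y y' : Vec p), ‖y - θstar‖ ≤ r → ‖y' - θstar‖ ≤ r →
        specNorm (hess t y - hess t y') ≤ L₃ * ‖y - y'‖) →
      -- (A4)
      K₁ * (p + x) ≤ (t₀ : ℝ) →
      (∀ t : ℕ, t₀ < t →
        ∑ s ∈ Finset.Icc (t₀ + 1) t, (ℓ s θstar - ℓ s (θ (s - 1))) ≤ K₃ * x) →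
      (∀ t : ℕ, t₀ < t → (t : ℕ∞) ≤ texit θstar r t₀ θ →
        ∑ s ∈ Finset.Icc (t₀ + 1) t, quadForm (Ω s)⁻¹ (grad s (θ (s - 1)))
          ≤ K₄ * p * Real.log t + K₅ * (x + Real.log t)) →
      -- (A5)
      ‖θ t₀ - θstar‖ ≤ r →
      quadForm (Ω t₀) (θ t₀ - θstar) ≤ C₀ * (p + x) →
      -- warm-start length
      ⌈M K₁ K₂ K₃ K₄ K₅ L₁ L₂ C₀ r * (p * Real.log (max (p : ℝ) 3) + x)⌉₊ ≤ t₀ →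
      -- conclusion
      ∀ t : ℕ, t₀ < t →
        (Ω t).PosDef ∧ (Fmat hess t θstar).PosDef ∧
        (∀ S : Mat p, S.PosSemidef → S * S = (Ω t)⁻¹ →
          specNorm (S * Fmat hess t θstar * S - 1)
            ≤ K K₂ K₃ K₄ K₅ L₃ lamBar0 C₀ *
                Real.sqrt ((p * Real.log t + x) / t)) ∧
        (∀ S : Mat p, S.PosSemidef → S * S = (Fmat hess t θstar)⁻¹ →
          specNorm (S * Ω t * S - 1)
            ≤ K K₂ K₃ K₄ K₅ L₃ lamBar0 C₀ *
                Real.sqrt ((p * Real.log t + x) / t)) := by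
  refine ⟨fun _ K₂ K₃ K₄ K₅ L₁ L₂ C₀ r =>
      3 + 25 / ((radConst K₂ K₃ K₄ K₅ L₁ L₂ C₀ r) ^ 2) ^ 2,
    fun K₂ K₃ K₄ K₅ L₃ lamBar0 C₀ =>
      lamBar0 / K₂ + 3 * L₃ * kapConst K₂ K₃ K₄ K₅ C₀ / K₂, ?_, ?_, ?_⟩
  · intros
    positivity
  · intro K₂ K₃ K₄ K₅ L₃ lamBar0 C₀ h2 _ _ _ h3 hl _
    have : 0 ≤ kapConst K₂ K₃ K₄ K₅ C₀ := Real.sqrt_nonneg _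
    positivity
  intro K₁ K₂ K₃ K₄ K₅ L₁ L₂ L₃ lamBar0 C₀ r hK₁ hK₂ hK₃ hK₄ hK₅ hL₁ hL₂ hL₃ hlam hC₀ hr
    p x θstar ℓ grad hess t₀ Ω₀ θ Ω hx hgrad hhess _ hΩ₀ hΩ₀le hΩt₀ hΩ hθ hpsd hA1 hA2 hA2n hA3
    hA4 hA4l hA4g hA5 hA5v hwarm t ht
  have hκ0 : 0 ≤ kapConst K₂ K₃ K₄ K₅ C₀ := Real.sqrt_nonneg _
  rcases Nat.eq_zero_or_pos p with hp0 | hp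
  · subst hp0
    have hpd : ∀ A : Mat 0, A.PosDef := by
      intro A
      refine posDef_of_quadForm (k := 1) (Subsingleton.elim _ _) one_pos fun v => ?_
      have : v = 0 := Subsingleton.elim _ _
      subst this
      simp [quadForm]
    have hsn : ∀ A : Mat 0, specNorm A ≤ (lamBar0 / K₂ + 3 * L₃ * kapConst K₂ K₃ K₄ K₅ C₀ / K₂) *
                Real.sqrt ((((0 : ℕ) : ℝ) * Real.log t + x) / t) := by
      intro A
      have h0 : specNorm A ≤ 0 := by
        refine specNorm_le_bound A le_rfl fun v => ?_
        have : mApp A v = 0 := Subsingleton.elim _ _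
        simp [this]
      exact h0.trans (by positivity)
    exact ⟨hpd _, hpd _, fun S _ _ => hsn _, fun S _ _ => hsn _⟩
  set C := C₀ + 2 * K₃ + K₄ + K₅ with hC
  set κ := kapConst K₂ K₃ K₄ K₅ C₀ with hκ
  have hκ' : κ = √(2 * C / K₂) := rfl
  set e := radConst K₂ K₃ K₄ K₅ L₁ L₂ C₀ r with he
  have hCp : 0 < C := by positivity
  have hκp : 0 < κ := by rw [hκ']; exact Real.sqrt_pos.mpr (by positivity)
  have hL : 0 ≤ L₁ * L₂ * κ ^ 3 := by positivity
  have hee : e = min (C / (16 * (L₁ * L₂ * κ ^ 3) + 1)) (r / κ) := rfl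
  have hep : 0 < e := by rw [hee]; exact lt_min (by positivity) (by positivity)
  have hwarm' : (3 + 25 / (e ^ 2) ^ 2) * (p * Real.log (max (p : ℝ) 3) + x) ≤ (t₀ : ℝ) :=
    (Nat.le_ceil _).trans (by exact_mod_cast hwarm)
  obtain ⟨ht₀3, hWt₀⟩ := warm_start (η := e ^ 2) (by positivity) rfl hp hx hwarm'
  have h : Setup K₁ K₂ K₃ K₄ K₅ L₁ L₂ L₃ lamBar0 C₀ r p x θstar ℓ grad hess t₀ Ω₀ θ Ω :=
    ⟨hp, ht₀3, hK₂, hK₃, hK₄, hK₅, hL₁, hL₂, hL₃, hlam, hC₀, hr, hx, hgrad, hhess, hΩ₀, hΩ₀le,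
      hΩt₀, hΩ, hθ, hpsd, hA1, hA2, hA2n, hA3, hA4, hA4l, hA4g, hA5, hA5v⟩
  have he1 : L₁ * L₂ * √(2 * C / K₂) ^ 3 * (16 * e) ≤ C := by
    rw [← hκ']
    have h1 : e ≤ C / (16 * (L₁ * L₂ * κ ^ 3) + 1) := by rw [hee]; exact min_le_left _ _
    rw [le_div_iff₀ (by positivity)] at h1
    linarith
  have he2 : √(2 * C / K₂) * e ≤ r := by
    rw [← hκ']
    have h1 : e ≤ r / κ := by rw [hee]; exact min_le_right _ _
    rw [le_div_iff₀ hκp] at h1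
    linarith
  have hse : √(((p : ℝ) * Real.log t₀ + x) / t₀) ≤ e := by
    rw [Real.sqrt_le_left hep.le]; exact hWt₀
  have hboot := h.bootstrap hC hse he1 he2
  have hin : ∀ s, t₀ ≤ s → ‖θ s - θstar‖ ≤ r := fun s hs => (hboot s hs).1
  have hb : ∀ s, t₀ ≤ s → ‖θ s - θstar‖ ≤ κ * √(((p : ℝ) * Real.log s + x) / s) := by
    intro s hs
    exact h.norm_bound hs (by positivity) (fun s hs _ => hin s hs) (hboot s hs).2
  have hdiff := h.diff_bound hκp.le hin hb t ht.le
  have ht3 := h.cast_pos ht.le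
  have ht0 : (0 : ℝ) < t := by linarith
  have hW := h.W_pos ht.le
  have hKt : 0 < K₂ * t := by positivity
  have hfin : specNorm (Ω t - Fmat hess t θstar) / (K₂ * t) ≤
      (lamBar0 / K₂ + 3 * L₃ * κ / K₂) * √((p * Real.log t + x) / t) := by
    rw [div_le_iff₀ hKt]
    refine hdiff.trans ?_
    have hst : √(t : ℝ) * √(t : ℝ) = t := Real.mul_self_sqrt ht0.le
    have hst1 : 1 ≤ √(t : ℝ) := Real.one_le_sqrt.mpr (by linarith)
    have hsw1 : 1 ≤ √(p * Real.log t + x) := Real.one_le_sqrt.mpr hW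
    have e1 : (lamBar0 / K₂ + 3 * L₃ * κ / K₂) * √((p * Real.log t + x) / t) * (K₂ * t) =
        (lamBar0 + 3 * L₃ * κ) * (√(p * Real.log t + x) * √(t : ℝ)) := by
      rw [Real.sqrt_div' _ ht0.le]
      have e2 : √(p * Real.log t + x) / √(t : ℝ) * t = √(p * Real.log t + x) * √(t : ℝ) := by
        rw [div_mul_eq_mul_div, mul_div_assoc, Real.div_sqrt]
      rw [← e2]
      field_simp
    rw [e1]
    have : 1 ≤ √(p * Real.log t + x) * √(t : ℝ) :=
      one_le_mul_of_one_le_of_one_le hsw1 hst1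
    rw [add_mul]
    have h1 := mul_le_mul_of_nonneg_left this hlam.le
    rw [mul_one] at h1
    exact add_le_add_left h1 _
  have hΩlow := h.Omega_lower ht.le (fun s hs _ => hin s hs)
  have hΩpd := h.Omega_posDef ht.le (fun s hs _ => hin s hs)
  have hFlow : ∀ v : Vec p, K₂ * t * ‖v‖ ^ 2 ≤ quadForm (Fmat hess t θstar) v :=
    hA1 t (hA4.trans (by exact_mod_cast ht.le)) (fun _ => θstar) (fun s _ => by simp [hr.le])
  have hFpd : (Fmat hess t θstar).PosDef :=
    posDef_of_quadForm (h.sum_herm _ (fun _ => θstar)) hKt hFlow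
  refine ⟨hΩpd, hFpd, fun S hS hSS => ?_, fun S hS hSS => ?_⟩
  · refine (sandwich hΩpd hKt hΩlow hS hSS).trans ?_
    rw [← neg_sub, specNorm_neg]
    exact hfin
  · exact (sandwich hFpd hKt hFlow hS hSS).trans hfin
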